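/- arXiv:2506.21036 — 9 statements merged into one kernel-verified Lean document; each statement's English description precedes it below -/
import Mathlib

section
/- Let b with 0 < b ≤ ∞ and let ψ : [0, b) → ℝ be a convex function with ψ(0) = 0 and right derivative ψ'(0) = 0 at 0, so that ψ is nonnegative and nondecreasing on [0, b). Define its Legendre dual ψ*(x) = sup_{λ ∈ [0,b)} (λ·x − ψ(λ)) for x ≥ 0, and its generalized inverse ψ*⁻¹(y) = sup { x ≥ 0 : ψ*(x) ≤ y }. Then for every y ≥ 0, ψ*⁻¹(y) = inf_{λ ∈ (0,b)} (y + ψ(λ))/λ (as an equality in the extended nonnegative reals). -/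
open scoped ENNReal

/-- The Legendre dual `ψ*(x) = sup_{λ ∈ [0,b)} (λ·x − ψ(λ))`, valued in `ℝ≥0∞`
(for `x ≥ 0` the supremum is nonnegative since `λ = 0` contributes `0`). -/
noncomputable def legendreDual (b : ℝ≥0∞) (ψ : ℝ → ℝ) (x : ℝ) : ℝ≥0∞ :=
  ⨆ l ∈ {l : ℝ | 0 ≤ l ∧ ENNReal.ofReal l < b}, ENNReal.ofReal (l * x - ψ l)

/-- The generalized inverse `ψ*⁻¹(y) = sup { x ≥ 0 : ψ*(x) ≤ y }`, valued in `ℝ≥0∞`. -/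
noncomputable def legendreDualInv (b : ℝ≥0∞) (ψ : ℝ → ℝ) (y : ℝ) : ℝ≥0∞ :=
  ⨆ x ∈ {x : ℝ | 0 ≤ x ∧ legendreDual b ψ x ≤ ENNReal.ofReal y}, ENNReal.ofReal x

/-- **Inverse Legendre dual lemma.** If `ψ` is convex on `[0, b)` with `ψ(0) = 0`
and right derivative `ψ'(0) = 0`, then for every `y ≥ 0`,
`ψ*⁻¹(y) = inf_{λ ∈ (0,b)} (y + ψ(λ))/λ` in the extended nonnegative reals. -/
theorem legendreDualInv_eq_iInf (b : ℝ≥0∞) (hb : 0 < b) (ψ : ℝ → ℝ)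
    (hconv : ConvexOn ℝ {l : ℝ | 0 ≤ l ∧ ENNReal.ofReal l < b} ψ)
    (hψ0 : ψ 0 = 0)
    (hψ'0 : HasDerivWithinAt ψ 0 (Set.Ici 0) 0)
    (y : ℝ) (hy : 0 ≤ y) :
    legendreDualInv b ψ y
      = ⨅ l ∈ {l : ℝ | 0 < l ∧ ENNReal.ofReal l < b}, ENNReal.ofReal ((y + ψ l) / l) := by
  have hψnn : ∀ l : ℝ, 0 < l → ENNReal.ofReal l < b → 0 ≤ ψ l := by
    intro l hl hlb
    have h := hconv.le_slope_of_hasDerivWithinAt_Ioi (x := 0) (y := l)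
      ⟨le_refl _, by simpa using hb⟩ ⟨hl.le, hlb⟩ hl (hψ'0.mono Set.Ioi_subset_Ici_self)
    rw [slope_def_field, hψ0, sub_zero, sub_zero] at h
    have h2 := mul_nonneg h hl.le
    rwa [div_mul_cancel₀ _ hl.ne'] at h2
  have hkey : ∀ x : ℝ, legendreDual b ψ x ≤ ENNReal.ofReal y ↔
      ∀ l : ℝ, 0 < l → ENNReal.ofReal l < b → x ≤ (y + ψ l) / l := by
    intro x
    unfold legendreDual
    simp only [iSup_le_iff, Set.mem_ofPred_eq]
    constructor
    · intro h l hl hlb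
      have h1 := (ENNReal.ofReal_le_ofReal_iff hy).1 (h l ⟨hl.le, hlb⟩)
      rw [le_div_iff₀ hl]
      linarith
    · rintro h l ⟨hl, hlb⟩
      apply ENNReal.ofReal_le_ofReal
      rcases hl.eq_or_lt with rfl | hl
      · simpa [hψ0] using hy
      · have h1 := h l hl hlb
        rw [le_div_iff₀ hl] at h1
        linarith
  unfold legendreDualInv
  apply le_antisymm
  · refine iSup₂_le fun x hx => le_iInf₂ fun l hl => ?_
    obtain ⟨_, hx⟩ := hx
    obtain ⟨hl, hlb⟩ := hl
    exact ENNReal.ofReal_le_ofReal ((hkey x).1 hx l hl hlb)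
  · set I := ⨅ l ∈ {l : ℝ | 0 < l ∧ ENNReal.ofReal l < b}, ENNReal.ofReal ((y + ψ l) / l) with hI
    have hle : ∀ l : ℝ, 0 < l → ENNReal.ofReal l < b → I ≤ ENNReal.ofReal ((y + ψ l) / l) :=
      fun l hl hlb => iInf₂_le l ⟨hl, hlb⟩
    obtain ⟨r, hr0, hrb⟩ := ENNReal.lt_iff_exists_nnreal_btwn.1 hb
    have hfin : I ≠ ∞ := ne_top_of_le_ne_top ENNReal.ofReal_ne_top
      (hle r (by exact_mod_cast hr0) (by simpa using hrb))
    rw [← ENNReal.ofReal_toReal hfin]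
    refine le_iSup₂_of_le I.toReal ⟨ENNReal.toReal_nonneg, (hkey _).2 ?_⟩ le_rfl
    intro l hl hlb
    exact ENNReal.toReal_le_of_le_ofReal
      (div_nonneg (add_nonneg hy (hψnn l hl hlb)) hl.le) (hle l hl hlb)
end

section
/- Fix real parameters r > 0, c > 0, K > 0, an integer D ≥ 2, α ∈ (0,1], and τ₂ ∈ (0,1]. Define B_p(p) = (r·c/(K·D)) · ( ((4α+1)τ₂ − α + 1)·p² − ((8α+2D)τ₂ + 2D − 2αD)·p + (2D+4α−1)τ₂ + 2D − 2αD − 1 + α ) and B_g(p) = (r·c/(K·D)) · ( 8τ₂(D−2+2α−αD)·(p²−p) + (2D+4α−6)τ₂ + 2D − 2αD − 2 + 2α ). Then there exists exactly one p* ∈ (0,1) with B_p(p*) = B_g(p*); moreover B_p(p) > B_g(p) for all p ∈ (0, p*) and B_p(p) < B_g(p) for all p ∈ (p*, 1). -/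
theorem quad_aux (a b d : ℝ) (h0 : 0 < d) (h1 : a + b + d < 0) :
    ∃ s ∈ Set.Ioo (0 : ℝ) 1, ∃ g : ℝ → ℝ, (∀ p ∈ Set.Ioo (0 : ℝ) 1, g p < 0) ∧
      ∀ p, a * p ^ 2 + b * p + d = (p - s) * g p := by
  have hc : ContinuousOn (fun p : ℝ => a * p ^ 2 + b * p + d) (Set.Icc 0 1) := by fun_prop
  have hi := intermediate_value_Ioo' zero_le_one hc
  obtain ⟨s, hs, hfs⟩ := hi (show (0 : ℝ) ∈ _ from ⟨by simpa using h1, by simpa using h0⟩)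
  simp only at hfs
  obtain ⟨hs0, hs1⟩ := hs
  refine ⟨s, ⟨hs0, hs1⟩, fun p => a * (p + s) + b, ?_, ?_⟩
  · rintro p ⟨hp0, hp1⟩
    have g0 : a * s + b < 0 := by
      by_contra! h
      nlinarith [mul_nonneg hs0.le h]
    have g1 : a * (1 + s) + b < 0 := by
      by_contra! h
      nlinarith [mul_nonneg (sub_pos.2 hs1).le h]
    show a * (p + s) + b < 0
    nlinarith [mul_pos hp0 (neg_pos.2 g1), mul_pos (sub_pos.2 hp1) (neg_pos.2 g0)]
  · intro p
    linear_combination hfs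

/-- **Unique intersection of the periodic and gradual bounds.** There is exactly one
`p* ∈ (0,1)` with `B_p(p*) = B_g(p*)`; moreover `B_p > B_g` on `(0, p*)` and
`B_p < B_g` on `(p*, 1)`. -/
theorem periodic_gradual_unique_intersection (r c K : ℝ) (hr : 0 < r) (hc : 0 < c)
    (hK : 0 < K) (D : ℕ) (hD : 2 ≤ D) (α τ₂ : ℝ) (hα : α ∈ Set.Ioc (0 : ℝ) 1)
    (hτ₂ : τ₂ ∈ Set.Ioc (0 : ℝ) 1)
    (Bp Bg : ℝ → ℝ)
    (hBp : ∀ p, Bp p = (r * c / (K * (D : ℝ))) *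
      (((4 * α + 1) * τ₂ - α + 1) * p ^ 2
        - ((8 * α + 2 * (D : ℝ)) * τ₂ + 2 * (D : ℝ) - 2 * α * (D : ℝ)) * p
        + (2 * (D : ℝ) + 4 * α - 1) * τ₂ + 2 * (D : ℝ) - 2 * α * (D : ℝ) - 1 + α))
    (hBg : ∀ p, Bg p = (r * c / (K * (D : ℝ))) *
      (8 * τ₂ * ((D : ℝ) - 2 + 2 * α - α * (D : ℝ)) * (p ^ 2 - p)
        + (2 * (D : ℝ) + 4 * α - 6) * τ₂ + 2 * (D : ℝ) - 2 * α * (D : ℝ) - 2 + 2 * α)) :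
    ∃ pstar ∈ Set.Ioo (0 : ℝ) 1,
      Bp pstar = Bg pstar ∧
      (∀ q ∈ Set.Ioo (0 : ℝ) 1, Bp q = Bg q → q = pstar) ∧
      (∀ p ∈ Set.Ioo (0 : ℝ) pstar, Bg p < Bp p) ∧
      (∀ p ∈ Set.Ioo pstar (1 : ℝ), Bp p < Bg p) := by
  obtain ⟨ha0, ha1⟩ := hα
  obtain ⟨ht0, ht1⟩ := hτ₂
  have hD' : (2 : ℝ) ≤ D := by exact_mod_cast hD
  have hM : 0 < r * c / (K * (D : ℝ)) := by positivity
  set M := r * c / (K * (D : ℝ)) with hMdef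
  obtain ⟨s, ⟨hs0, hs1⟩, g, hg, hfac⟩ := quad_aux
    ((4 * α + 1) * τ₂ - α + 1 - 8 * τ₂ * ((D : ℝ) - 2 + 2 * α - α * (D : ℝ)))
    (-((8 * α + 2 * (D : ℝ)) * τ₂ + 2 * (D : ℝ) - 2 * α * (D : ℝ))
      + 8 * τ₂ * ((D : ℝ) - 2 + 2 * α - α * (D : ℝ)))
    (5 * τ₂ + 1 - α) (by linarith) (by
      nlinarith [mul_nonneg ht0.le (sub_nonneg.2 hD'), mul_pos ht0 ha0,
        mul_nonneg (sub_nonneg.2 ha1) (sub_nonneg.2 hD'),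
        mul_nonneg (sub_nonneg.2 ha1) (sub_nonneg.2 ht1)])
  have key : ∀ p, Bp p - Bg p = M * ((p - s) * g p) := by
    intro p
    rw [hBp, hBg, ← hfac]
    ring
  refine ⟨s, ⟨hs0, hs1⟩, ?_, ?_, ?_, ?_⟩
  · have := key s
    simp only [sub_self, zero_mul, mul_zero] at this
    linarith
  · intro q hq h
    have h2 := key q
    rw [h, sub_self] at h2
    rcases mul_eq_zero.1 h2.symm with h3 | h3
    · exact absurd h3 hM.ne'
    · rcases mul_eq_zero.1 h3 with h4 | h4
      · linarith
      · exact absurd h4 (hg q hq).ne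
  · rintro p ⟨hp0, hp1⟩
    have := mul_pos hM (mul_pos_of_neg_of_neg (sub_neg.2 hp1) (hg p ⟨hp0, hp1.trans hs1⟩))
    linarith [key p]
  · rintro p ⟨hp0, hp1⟩
    have := mul_neg_of_pos_of_neg hM
      (mul_neg_of_pos_of_neg (sub_pos.2 hp0) (hg p ⟨hs0.trans hp0, hp1⟩))
    linarith [key p]
end

section
/- Fix real parameters r > 0, c > 0, K > 0, an integer D ≥ 2, α ∈ (0,1], and τ₂ ∈ (0,1]. Define B_p(p) = (r·c/(K·D)) · ( ((4α+1)τ₂ − α + 1)·p² − ((8α+2D)τ₂ + 2D − 2αD)·p + (2D+4α−1)τ₂ + 2D − 2αD − 1 + α ), B_g(p) = (r·c/(K·D)) · ( 8τ₂(D−2+2α−αD)·(p²−p) + (2D+4α−6)τ₂ + 2D − 2αD − 2 + 2α ), and the constant B_r = (r·c/K)·(τ₂·α − α + 1)·((5/3)·D + 1/(3D) − 2). Assume additionally that B_r ≥ B_p(0). Then there exists p_th ∈ (0, 1/2] such that for every p ∈ (0, p_th), B_r > B_p(p) > B_g(p). -/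
/-- **Proposition 1 (Threshold).** If the random-pattern bound `B_r` dominates the
periodic-pattern bound at `p = 0`, then there is a threshold `p_th ∈ (0, 1/2]` such
that `B_r > B_p(p) > B_g(p)` for every `p ∈ (0, p_th)`. -/
theorem threshold_proposition (r c K : ℝ) (hr : 0 < r) (hc : 0 < c)
    (hK : 0 < K) (D : ℕ) (hD : 2 ≤ D) (α τ₂ : ℝ) (hα : α ∈ Set.Ioc (0 : ℝ) 1)
    (hτ₂ : τ₂ ∈ Set.Ioc (0 : ℝ) 1)
    (Bp Bg : ℝ → ℝ) (Br : ℝ)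
    (hBp : ∀ p, Bp p = (r * c / (K * (D : ℝ))) *
      (((4 * α + 1) * τ₂ - α + 1) * p ^ 2
        - ((8 * α + 2 * (D : ℝ)) * τ₂ + 2 * (D : ℝ) - 2 * α * (D : ℝ)) * p
        + (2 * (D : ℝ) + 4 * α - 1) * τ₂ + 2 * (D : ℝ) - 2 * α * (D : ℝ) - 1 + α))
    (hBg : ∀ p, Bg p = (r * c / (K * (D : ℝ))) *
      (8 * τ₂ * ((D : ℝ) - 2 + 2 * α - α * (D : ℝ)) * (p ^ 2 - p)
        + (2 * (D : ℝ) + 4 * α - 6) * τ₂ + 2 * (D : ℝ) - 2 * α * (D : ℝ) - 2 + 2 * α))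
    (hBr : Br = (r * c / K) * (τ₂ * α - α + 1) *
      ((5 / 3) * (D : ℝ) + 1 / (3 * (D : ℝ)) - 2))
    (hdom : Bp 0 ≤ Br) :
    ∃ pth ∈ Set.Ioc (0 : ℝ) (1 / 2),
      ∀ p ∈ Set.Ioo (0 : ℝ) pth, Bg p < Bp p ∧ Bp p < Br := by
  obtain ⟨ha0, ha1⟩ := hα
  obtain ⟨ht0, ht1⟩ := hτ₂
  have hd : (2 : ℝ) ≤ (D : ℝ) := by exact_mod_cast hD
  have hC : 0 < r * c / (K * (D : ℝ)) := by positivity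
  generalize (D : ℝ) = d at *
  have hat : 0 < α * τ₂ := mul_pos ha0 ht0
  have hdt : 2 * τ₂ ≤ d * τ₂ := by nlinarith
  have hda : 2 * (1 - α) ≤ d * (1 - α) := by nlinarith
  have hB : 0 < (8 * α + 2 * d) * τ₂ + 2 * d - 2 * α * d := by nlinarith
  have hE : 0 < 5 * τ₂ + 1 - α := by linarith
  have hA : 0 < (4 * α + 1) * τ₂ - α + 1 := by nlinarith
  have hAB : (4 * α + 1) * τ₂ - α + 1 < (8 * α + 2 * d) * τ₂ + 2 * d - 2 * α * d := by
    nlinarith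
  refine ⟨min (1 / 2) ((5 * τ₂ + 1 - α) / ((8 * α + 2 * d) * τ₂ + 2 * d - 2 * α * d)),
    ⟨lt_min (by norm_num) (div_pos hE hB), min_le_left _ _⟩, ?_⟩
  rintro p ⟨hp0, hp⟩
  have hp1 := lt_of_lt_of_le hp (min_le_left _ _)
  have hp2 := lt_of_lt_of_le hp (min_le_right _ _)
  rw [lt_div_iff₀ hB] at hp2
  constructor
  · rw [hBp, hBg]
    apply mul_lt_mul_of_pos_left _ hC
    have h1 : 0 ≤ τ₂ * ((d - 2) * (1 - α)) * (p * (1 - p)) :=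
      mul_nonneg (mul_nonneg ht0.le (mul_nonneg (by linarith) (by linarith)))
        (mul_nonneg hp0.le (by linarith))
    have h2 : 0 < ((4 * α + 1) * τ₂ - α + 1) * p ^ 2 := by positivity
    linarith
  · refine lt_of_lt_of_le ?_ hdom
    rw [hBp, hBp]
    apply mul_lt_mul_of_pos_left _ hC
    have h1 := mul_lt_mul_of_pos_right hAB hp0
    have h2 : 0 < ((4 * α + 1) * τ₂ - α + 1) * (p * (1 - p)) :=
      mul_pos hA (mul_pos hp0 (by linarith))
    linarith
end

section
/- Fix real parameters r > 0, c > 0, K > 0, an integer D ≥ 2, and α ∈ (0,1]. For τ₂ ∈ (0,1], define B_p(p; τ₂) = (r·c/(K·D)) · ( ((4α+1)τ₂ − α + 1)·p² − ((8α+2D)τ₂ + 2D − 2αD)·p + (2D+4α−1)τ₂ + 2D − 2αD − 1 + α ) and B_r(τ₂) = (r·c/K)·(τ₂·α − α + 1)·((5/3)·D + 1/(3D) − 2). Then: (i) for each fixed p ∈ (0,1), the map τ₂ ↦ B_p(p; τ₂) is strictly increasing on (0,1]; and (ii) if α > 0, the map τ₂ ↦ B_r(τ₂) is strictly increasing on (0,1].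 Consequently both bounds decrease when τ₂ decreases. -/
/-- **τ₂-monotonicity (Proposition 2).** For every fixed `p ∈ (0,1)` the
periodic-pattern bound `B_p(p; τ₂)` is strictly increasing in `τ₂` on `(0,1]`, and
(for `α > 0`) the random-pattern bound `B_r(τ₂)` is strictly increasing in `τ₂` on
`(0,1]`; consequently both bounds decrease when `τ₂` decreases. -/
theorem tau2_monotonicity (r c K : ℝ) (hr : 0 < r) (hc : 0 < c) (hK : 0 < K)
    (D : ℕ) (hD : 2 ≤ D) (α : ℝ) (hα : α ∈ Set.Ioc (0 : ℝ) 1) :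
    (∀ p ∈ Set.Ioo (0 : ℝ) 1,
      StrictMonoOn (fun τ₂ : ℝ => (r * c / (K * (D : ℝ))) *
        (((4 * α + 1) * τ₂ - α + 1) * p ^ 2
          - ((8 * α + 2 * (D : ℝ)) * τ₂ + 2 * (D : ℝ) - 2 * α * (D : ℝ)) * p
          + (2 * (D : ℝ) + 4 * α - 1) * τ₂ + 2 * (D : ℝ) - 2 * α * (D : ℝ) - 1 + α))
        (Set.Ioc 0 1)) ∧
    (0 < α →
      StrictMonoOn (fun τ₂ : ℝ => (r * c / K) * (τ₂ * α - α + 1) *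
        ((5 / 3) * (D : ℝ) + 1 / (3 * (D : ℝ)) - 2))
        (Set.Ioc 0 1)) := by
  have hD' : (2 : ℝ) ≤ (D : ℝ) := by exact_mod_cast hD
  have hD0 : (0 : ℝ) < (D : ℝ) := by linarith
  obtain ⟨hα0, hα1⟩ := hα
  constructor
  · rintro p ⟨hp0, hp1⟩ x _ y _ hxy
    have hA : 0 < r * c / (K * (D : ℝ)) := by positivity
    have h2 : 0 < (2 * (D : ℝ) + 4 * α - 1) - (4 * α + 1) * p := by nlinarith
    have h3 : 0 < (y - x) * ((1 - p) * ((2 * (D : ℝ) + 4 * α - 1) - (4 * α + 1) * p)) :=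
      mul_pos (sub_pos.2 hxy) (mul_pos (sub_pos.2 hp1) h2)
    refine mul_lt_mul_of_pos_left ?_ hA
    linarith
  · intro _ x _ y _ hxy
    have hA : 0 < r * c / K := by positivity
    have h1 : 0 < 1 / (3 * (D : ℝ)) := by positivity
    refine mul_lt_mul_of_pos_right (mul_lt_mul_of_pos_left ?_ hA) (by linarith)
    nlinarith
end

section
/- Fix real parameters r > 0, c > 0, an integer D ≥ 2, α ∈ (0,1], τ₂ ∈ (0,1], and p ∈ (0,1). Define, as functions of K > 0, B_p(K) = (r·c/(K·D)) · ( ((4α+1)τ₂ − α + 1)·p² − ((8α+2D)τ₂ + 2D − 2αD)·p + (2D+4α−1)τ₂ + 2D − 2αD − 1 + α ), B_g(K) = (r·c/(K·D)) · ( 8τ₂(D−2+2α−αD)·(p²−p) + (2D+4α−6)τ₂ + 2D − 2αD − 2 + 2α ), and B_r(K) = (r·c/K)·(τ₂·α − α + 1)·((5/3)·D + 1/(3D) − 2). Then each of B_p(K), B_g(K), B_r(K) is strictly positive and strictly decreasing as a function of K on (0, ∞). -/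
/-- **K-monotonicity (Proposition 2).** As functions of the number of clients
`K > 0`, the three pattern bounds `B_p`, `B_g`, `B_r` are strictly positive and
strictly decreasing on `(0, ∞)`. -/
theorem K_monotonicity (r c : ℝ) (hr : 0 < r) (hc : 0 < c)
    (D : ℕ) (hD : 2 ≤ D) (α τ₂ p : ℝ) (hα : α ∈ Set.Ioc (0 : ℝ) 1)
    (hτ₂ : τ₂ ∈ Set.Ioc (0 : ℝ) 1) (hp : p ∈ Set.Ioo (0 : ℝ) 1)
    (Bp Bg Br : ℝ → ℝ)
    (hBp : ∀ K, Bp K = (r * c / (K * (D : ℝ))) *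
      (((4 * α + 1) * τ₂ - α + 1) * p ^ 2
        - ((8 * α + 2 * (D : ℝ)) * τ₂ + 2 * (D : ℝ) - 2 * α * (D : ℝ)) * p
        + (2 * (D : ℝ) + 4 * α - 1) * τ₂ + 2 * (D : ℝ) - 2 * α * (D : ℝ) - 1 + α))
    (hBg : ∀ K, Bg K = (r * c / (K * (D : ℝ))) *
      (8 * τ₂ * ((D : ℝ) - 2 + 2 * α - α * (D : ℝ)) * (p ^ 2 - p)
        + (2 * (D : ℝ) + 4 * α - 6) * τ₂ + 2 * (D : ℝ) - 2 * α * (D : ℝ) - 2 + 2 * α))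
    (hBr : ∀ K, Br K = (r * c / K) * (τ₂ * α - α + 1) *
      ((5 / 3) * (D : ℝ) + 1 / (3 * (D : ℝ)) - 2)) :
    (∀ K ∈ Set.Ioi (0 : ℝ), 0 < Bp K ∧ 0 < Bg K ∧ 0 < Br K) ∧
    StrictAntiOn Bp (Set.Ioi 0) ∧ StrictAntiOn Bg (Set.Ioi 0) ∧
    StrictAntiOn Br (Set.Ioi 0) := by
  obtain ⟨ha0, ha1⟩ := hα
  obtain ⟨ht0, ht1⟩ := hτ₂
  obtain ⟨hp0, hp1⟩ := hp
  have hd : (2 : ℝ) ≤ (D : ℝ) := by exact_mod_cast hD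
  generalize (D : ℝ) = d at *
  have hd0 : 0 < d := by linarith
  have hrc : 0 < r * c := mul_pos hr hc
  have h1 : 0 < ((4 * α + 1) * τ₂ - α + 1) * p ^ 2
        - ((8 * α + 2 * d) * τ₂ + 2 * d - 2 * α * d) * p
        + (2 * d + 4 * α - 1) * τ₂ + 2 * d - 2 * α * d - 1 + α := by
    have e1 : 0 < α * τ₂ * (1 - p) ^ 2 :=
      mul_pos (mul_pos ha0 ht0) (pow_pos (by linarith) 2)
    have e2 : 0 ≤ (τ₂ + (1 - α)) * ((1 - p) * (2 * d - 1 - p)) :=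
      mul_nonneg (by linarith) (mul_nonneg (by linarith) (by linarith))
    linarith
  have h2 : 0 < 8 * τ₂ * (d - 2 + 2 * α - α * d) * (p ^ 2 - p)
        + (2 * d + 4 * α - 6) * τ₂ + 2 * d - 2 * α * d - 2 + 2 * α := by
    have e1 : 0 ≤ τ₂ * ((1 - α) * (d - 2)) * (2 * p - 1) ^ 2 :=
      mul_nonneg (mul_nonneg ht0.le (mul_nonneg (by linarith) (by linarith))) (sq_nonneg _)
    have e2 : 0 ≤ (1 - τ₂) * ((1 - α) * (2 * d - 2)) :=
      mul_nonneg (by linarith) (mul_nonneg (by linarith) (by linarith))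
    have e3 : 0 < τ₂ * (2 * d - 2 - 2 * (1 - α)) := mul_pos ht0 (by linarith)
    linarith
  have h3 : 0 < (τ₂ * α - α + 1) * ((5 / 3) * d + 1 / (3 * d) - 2) := by
    have e1 : 0 < τ₂ * α := mul_pos ht0 ha0
    have e2 : 0 < 1 / (3 * d) := by positivity
    exact mul_pos (by linarith) (by linarith)
  generalize ((4 * α + 1) * τ₂ - α + 1) * p ^ 2
        - ((8 * α + 2 * d) * τ₂ + 2 * d - 2 * α * d) * p
        + (2 * d + 4 * α - 1) * τ₂ + 2 * d - 2 * α * d - 1 + α = x at *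
  generalize 8 * τ₂ * (d - 2 + 2 * α - α * d) * (p ^ 2 - p)
        + (2 * d + 4 * α - 6) * τ₂ + 2 * d - 2 * α * d - 2 + 2 * α = y at *
  simp only [mul_assoc (r * c / _)] at hBr
  generalize (τ₂ * α - α + 1) * ((5 / 3) * d + 1 / (3 * d) - 2) = z at *
  refine ⟨fun K hK => ?_, fun a ha b hb hab => ?_, fun a ha b hb hab => ?_,
    fun a ha b hb hab => ?_⟩
  · have hK : 0 < K := hK
    rw [hBp, hBg, hBr]
    exact ⟨by positivity, by positivity, by positivity⟩
  · have ha : 0 < a := ha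
    rw [hBp, hBp]
    gcongr
  · have ha : 0 < a := ha
    rw [hBg, hBg]
    gcongr
  · have ha : 0 < a := ha
    rw [hBr, hBr]
    gcongr
end

section
/- Fix real parameters r > 0, c > 0, K > 0, τ₂ ∈ (0,1], and p ∈ (0,1). (i) If D ≥ 3 is an integer, then the map α ↦ B_p(p; α) = (r·c/(K·D)) · ( ((4α+1)τ₂ − α + 1)·p² − ((8α+2D)τ₂ + 2D − 2αD)·p + (2D+4α−1)τ₂ + 2D − 2αD − 1 + α ) is strictly decreasing on (0, 1). (ii) If D ≥ 2 and τ₂ < 1, then the map α ↦ B_r(α) = (r·c/K)·(τ₂·α − α + 1)·((5/3)·D + 1/(3D) − 2) is strictly decreasing on (0, 1). -/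
/-- **α-monotonicity (Proposition 2).** (i) For `D ≥ 3`, the periodic-pattern bound
`B_p(p; α)` is strictly decreasing in `α` on `(0, 1)`. (ii) For `D ≥ 2` and `τ₂ < 1`,
the random-pattern bound `B_r(α)` is strictly decreasing in `α` on `(0, 1)`. -/
theorem alpha_monotonicity (r c K : ℝ) (hr : 0 < r) (hc : 0 < c) (hK : 0 < K)
    (τ₂ p : ℝ) (hτ₂ : τ₂ ∈ Set.Ioc (0 : ℝ) 1) (hp : p ∈ Set.Ioo (0 : ℝ) 1)
    (D : ℕ) (hD : 2 ≤ D) :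
    (3 ≤ D →
      StrictAntiOn (fun α : ℝ => (r * c / (K * (D : ℝ))) *
        (((4 * α + 1) * τ₂ - α + 1) * p ^ 2
          - ((8 * α + 2 * (D : ℝ)) * τ₂ + 2 * (D : ℝ) - 2 * α * (D : ℝ)) * p
          + (2 * (D : ℝ) + 4 * α - 1) * τ₂ + 2 * (D : ℝ) - 2 * α * (D : ℝ) - 1 + α))
        (Set.Ioo 0 1)) ∧
    (τ₂ < 1 →
      StrictAntiOn (fun α : ℝ => (r * c / K) * (τ₂ * α - α + 1) *
        ((5 / 3) * (D : ℝ) + 1 / (3 * (D : ℝ)) - 2))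
        (Set.Ioo 0 1)) := by
  obtain ⟨ht0, ht1⟩ := hτ₂
  obtain ⟨hp0, hp1⟩ := hp
  have hD2 : (2 : ℝ) ≤ (D : ℝ) := by exact_mod_cast hD
  have hDpos : (0 : ℝ) < (D : ℝ) := by linarith
  refine ⟨fun h3 => ?_, fun ht => ?_⟩
  · have hD3 : (3 : ℝ) ≤ (D : ℝ) := by exact_mod_cast h3
    intro a _ b _ hab
    have hq : 0 < 4 * τ₂ * (p - 1) - p + 2 * (D : ℝ) - 1 := by
      have : 0 ≤ (1 - τ₂) * (1 - p) := mul_nonneg (by linarith) (by linarith)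
      nlinarith
    have hpos : 0 < (b - a) * ((1 - p) * (4 * τ₂ * (p - 1) - p + 2 * (D : ℝ) - 1)) :=
      mul_pos (by linarith) (mul_pos (by linarith) hq)
    have hk : 0 < r * c / (K * (D : ℝ)) := by positivity
    refine mul_lt_mul_of_pos_left ?_ hk
    linarith
  · intro a _ b _ hab
    have hk : 0 < r * c / K := by positivity
    have hi : 0 < 1 / (3 * (D : ℝ)) := by positivity
    refine mul_lt_mul_of_pos_right (mul_lt_mul_of_pos_left ?_ hk) (by linarith)
    have := mul_pos (sub_pos.2 hab) (sub_pos.2 ht)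
    linarith
end

section
/- Consider K clients with, for each k, constants A_k > 0, B_k ≥ 0, u_k ≥ 0, v_k > 0, w_k > 0, client cost function C_k(f) = u_k + v_k·f + w_k·f² for f > 0, round duration φ(f) = max_{k} (A_k/f_k + B_k) for f ∈ (0,∞)^K, constants R > 0, a > 0, b ∈ ℝ, objective B(f) = a·R·φ(f) + b, and budget C̄ with nonempty feasible set { f ∈ (0,∞)^K : Σ_k C_k(f_k) ≤ C̄ }. If f* ∈ (0,∞)^K is a minimizer of B over this feasible set, then the per-round times are equalized: A_j/f*_j + B_j = A_k/f*_k + B_k for all clients j, k. -/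
/-- **Lemma 3 (equalized per-round times at the optimum).** If `f*` minimizes the
objective `B(f) = a·R·φ(f) + b`, with round duration `φ(f) = max_k (A_k/f_k + B_k)`,
over the feasible set `{ f ∈ (0,∞)^K : Σ_k C_k(f_k) ≤ C̄ }` where
`C_k(f) = u_k + v_k·f + w_k·f²`, then the per-round times are equalized:
`A_j/f*_j + B_j = A_k/f*_k + B_k` for all clients `j, k`. -/
theorem times_equalized_at_optimum (K : ℕ) (hK : 0 < K)
    (A B u v w : Fin K → ℝ)
    (hA : ∀ k, 0 < A k) (hB : ∀ k, 0 ≤ B k) (hu : ∀ k, 0 ≤ u k)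
    (hv : ∀ k, 0 < v k) (hw : ∀ k, 0 < w k)
    (R a b Cbar : ℝ) (hR : 0 < R) (ha : 0 < a)
    (fstar : Fin K → ℝ)
    (hfeas : (∀ k, 0 < fstar k) ∧
      (∑ k, (u k + v k * fstar k + w k * fstar k ^ 2)) ≤ Cbar)
    (hmin : ∀ f : Fin K → ℝ, (∀ k, 0 < f k) →
      (∑ k, (u k + v k * f k + w k * f k ^ 2)) ≤ Cbar →
      a * R * (⨆ k, (A k / fstar k + B k)) + b ≤ a * R * (⨆ k, (A k / f k + B k)) + b) :
    ∀ j k : Fin K, A j / fstar j + B j = A k / fstar k + B k := by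
  obtain ⟨hpos, hcost⟩ := hfeas
  haveI : Nonempty (Fin K) := ⟨⟨0, hK⟩⟩
  set M := ⨆ k, (A k / fstar k + B k) with hM
  have hle : ∀ k, A k / fstar k + B k ≤ M := fun k =>
    le_ciSup (f := fun k => A k / fstar k + B k) (Set.finite_range _).bddAbove k
  suffices h : ∀ j, A j / fstar j + B j = M by
    intro j k
    rw [h j, h k]
  intro j
  by_contra hne
  have hlt : A j / fstar j + B j < M := lt_of_le_of_ne (hle j) hne
  have hq : 0 < A j / fstar j := div_pos (hA j) (hpos j)
  have hMB : 0 < M - B j := by linarith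
  set y := A j / (M - B j) with hy
  have hy0 : 0 < y := div_pos (hA j) hMB
  have hyf : y < fstar j := by
    rw [hy, div_lt_iff₀ hMB]
    have : A j / fstar j < M - B j := by linarith
    rw [div_lt_iff₀ (hpos j)] at this
    linarith
  have hyM : A j / y + B j = M := by
    have h1 : A j / y = M - B j := by
      rw [hy]
      have := (hA j).ne'
      field_simp
    linarith
  set g : Fin K → ℝ := Function.update fstar j y with hg
  have hgj : g j = y := by simp [hg]
  have hgk : ∀ k, k ≠ j → g k = fstar k := fun k hk => by simp [hg, hk]
  have hgpos : ∀ k, 0 < g k := by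
    intro k
    by_cases hk : k = j
    · subst hk; rw [hgj]; exact hy0
    · rw [hgk k hk]; exact hpos k
  have hgM : ∀ k, A k / g k + B k ≤ M := by
    intro k
    by_cases hk : k = j
    · subst hk; rw [hgj]; exact hyM.le
    · rw [hgk k hk]; exact hle k
  have hgcost : (∑ k, (u k + v k * g k + w k * g k ^ 2)) < Cbar := by
    refine lt_of_lt_of_le (Finset.sum_lt_sum ?_ ⟨j, Finset.mem_univ j, ?_⟩) hcost
    · intro k _
      by_cases hk : k = j
      · subst hk
        rw [hgj]
        have h1 := hv k
        have h2 := hw k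
        gcongr
      · rw [hgk k hk]
    · rw [hgj]
      have h1 := hv j
      have h2 := hw j
      gcongr
  have hcont : Continuous (fun t : ℝ => ∑ k, (u k + v k * (t * g k) + w k * (t * g k) ^ 2)) := by
    fun_prop
  have hev : ∀ᶠ t in nhdsWithin (1 : ℝ) (Set.Ioi 1),
      (∑ k, (u k + v k * (t * g k) + w k * (t * g k) ^ 2)) < Cbar := by
    apply nhdsWithin_le_nhds
    exact hcont.continuousAt.eventually_lt continuousAt_const (by simpa using hgcost)
  obtain ⟨t, htc, ht⟩ := (hev.and self_mem_nhdsWithin).exists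
  have ht1 : 1 < t := ht
  have ht0 : 0 < t := by linarith
  have hm := hmin (fun k => t * g k) (fun k => mul_pos ht0 (hgpos k)) htc.le
  have hsup : (⨆ k, (A k / (t * g k) + B k)) < M := by
    obtain ⟨i, hi⟩ := exists_eq_ciSup_of_finite (f := fun k => A k / (t * g k) + B k)
    rw [← hi]
    have h1 : A i / (t * g i) < A i / g i :=
      div_lt_div_of_pos_left (hA i) (hgpos i) (by nlinarith [hgpos i])
    have h2 := hgM i
    show A i / (t * g i) + B i < M
    linarith
  have := mul_lt_mul_of_pos_left hsup (mul_pos ha hR)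
  linarith
end

section
/- Consider K clients with, for each k, constants A_k > 0, B_k ≥ 0, u_k ≥ 0, v_k > 0, w_k > 0, client cost function C_k(f) = u_k + v_k·f + w_k·f² for f > 0, round duration φ(f) = max_{k} (A_k/f_k + B_k) for f ∈ (0,∞)^K, constants R > 0, a > 0, b ∈ ℝ, and budget C̄. Define problem (P): minimize a·R·φ(f) + b over { f ∈ (0,∞)^K : Σ_k C_k(f_k) ≤ C̄ }, and problem (P'): minimize a·τ + b over { τ ∈ ℝ : τ > R·max_k B_k and Σ_k C_k( A_k·R/(τ − R·B_k) ) = C̄ }. If τ* is an optimal solution of (P'), then the capacity vector f* defined by f*_k = A_k·R/(τ* − R·B_k) for each k is an optimal solution of (P), and the optimal values coincide: a·R·φ(f*) + b = a·τ* + b. -/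
/-- **Proposition 3 (equivalence of the two formulations).** If `τ*` is optimal for
the reformulated problem (P'): minimize `a·τ + b` over
`{ τ : τ > R·max_k B_k and Σ_k C_k(A_k·R/(τ − R·B_k)) = C̄ }`,
then `f*` with `f*_k = A_k·R/(τ* − R·B_k)` is optimal for the original problem (P):
minimize `a·R·φ(f) + b` over `{ f ∈ (0,∞)^K : Σ_k C_k(f_k) ≤ C̄ }`, where
`φ(f) = max_k (A_k/f_k + B_k)` and `C_k(f) = u_k + v_k·f + w_k·f²`; moreover the
optimal values coincide. -/
theorem reformulation_equivalence (K : ℕ) (hK : 0 < K)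
    (A B u v w : Fin K → ℝ)
    (hA : ∀ k, 0 < A k) (hB : ∀ k, 0 ≤ B k) (hu : ∀ k, 0 ≤ u k)
    (hv : ∀ k, 0 < v k) (hw : ∀ k, 0 < w k)
    (R a b Cbar : ℝ) (hR : 0 < R) (ha : 0 < a)
    (τstar : ℝ)
    (hτfeas : (∀ k, R * B k < τstar) ∧
      (∑ k, (u k + v k * (A k * R / (τstar - R * B k))
        + w k * (A k * R / (τstar - R * B k)) ^ 2)) = Cbar)
    (hτmin : ∀ τ : ℝ, (∀ k, R * B k < τ) →
      (∑ k, (u k + v k * (A k * R / (τ - R * B k))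
        + w k * (A k * R / (τ - R * B k)) ^ 2)) = Cbar →
      a * τstar + b ≤ a * τ + b)
    (fstar : Fin K → ℝ) (hfstar : ∀ k, fstar k = A k * R / (τstar - R * B k)) :
    (∀ k, 0 < fstar k) ∧
    (∑ k, (u k + v k * fstar k + w k * fstar k ^ 2)) ≤ Cbar ∧
    (∀ f : Fin K → ℝ, (∀ k, 0 < f k) →
      (∑ k, (u k + v k * f k + w k * f k ^ 2)) ≤ Cbar →
      a * R * (⨆ k, (A k / fstar k + B k)) + b ≤ a * R * (⨆ k, (A k / f k + B k)) + b) ∧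
    a * R * (⨆ k, (A k / fstar k + B k)) + b = a * τstar + b := by
  obtain ⟨hlt, hsum⟩ := hτfeas
  haveI : Nonempty (Fin K) := ⟨⟨0, hK⟩⟩
  have hpos : ∀ k, 0 < fstar k := by
    intro k
    rw [hfstar k]
    exact div_pos (mul_pos (hA k) hR) (sub_pos.mpr (hlt k))
  have hcost : (∑ k, (u k + v k * fstar k + w k * fstar k ^ 2)) = Cbar := by
    rw [← hsum]
    exact Finset.sum_congr rfl (fun k _ => by rw [hfstar k])
  have hval : ∀ k, A k / fstar k + B k = τstar / R := by
    intro k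
    have h1 : τstar - R * B k ≠ 0 := (sub_pos.mpr (hlt k)).ne'
    have h2 := (hA k).ne'
    have h3 := hR.ne'
    rw [hfstar k]
    field_simp
    ring
  have hsup : (⨆ k, (A k / fstar k + B k)) = τstar / R := by
    simp only [hval, ciSup_const]
  refine ⟨hpos, hcost.le, ?_, ?_⟩
  · intro f hf hfc
    have hex : ∃ k, f k ≤ fstar k := by
      by_contra hne
      have hne' : ∀ k, fstar k < f k := fun k => lt_of_not_ge (fun h => hne ⟨k, h⟩)
      have : (∑ k, (u k + v k * fstar k + w k * fstar k ^ 2))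
          < ∑ k, (u k + v k * f k + w k * f k ^ 2) := by
        apply Finset.sum_lt_sum_of_nonempty Finset.univ_nonempty
        intro k _
        have h1 := mul_lt_mul_of_pos_left (hne' k) (hv k)
        have h2 := mul_lt_mul_of_pos_left
          (pow_lt_pow_left₀ (hne' k) (hpos k).le two_ne_zero) (hw k)
        linarith
      linarith
    obtain ⟨k, hk⟩ := hex
    have h1 : A k / fstar k ≤ A k / f k :=
      div_le_div_of_nonneg_left (hA k).le (hf k) hk
    have h2 : A k / f k + B k ≤ ⨆ k, (A k / f k + B k) :=
      le_ciSup (f := fun k => A k / f k + B k) (Set.finite_range _).bddAbove k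
    have h3 : (⨆ k, (A k / fstar k + B k)) ≤ ⨆ k, (A k / f k + B k) := by
      rw [hsup, ← hval k]
      linarith
    have h4 := mul_le_mul_of_nonneg_left h3 (mul_pos ha hR).le
    linarith
  · rw [hsup]
    have h3 := hR.ne'
    field_simp
end

section
/- Consider K clients with, for each k, constants A_k > 0, B_k ≥ 0, u_k ≥ 0, v_k > 0, w_k > 0, client cost function C_k(f) = u_k + v_k·f + w_k·f² for f > 0, round duration φ(f) = max_{k} (A_k/f_k + B_k) for f ∈ (0,∞)^K, constants R > 0, a > 0, b ∈ ℝ, and budget C̄ with nonempty feasible set { f ∈ (0,∞)^K : Σ_k C_k(f_k) ≤ C̄ }. If f* is a minimizer of a·R·φ(f) + b over the feasible set, and B* = a·R·φ(f*) + b is the optimal value, then (B* − b)/a > R·B_k for every k, and Σ_k C_k( A_k·R / ( (B* − b)/a − R·B_k ) ) = C̄. -/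
/-- **Theorem 2 (Performance–Cost Tradeoff).** If `f*` minimizes
`a·R·φ(f) + b` over `{ f ∈ (0,∞)^K : Σ_k C_k(f_k) ≤ C̄ }`, with
`φ(f) = max_k (A_k/f_k + B_k)` and `C_k(f) = u_k + v_k·f + w_k·f²`, and
`B* = a·R·φ(f*) + b` is the optimal value, then `(B* − b)/a > R·B_k` for every `k`
and `Σ_k C_k( A_k·R / ((B* − b)/a − R·B_k) ) = C̄`. -/
theorem pareto_frontier_equation (K : ℕ) (hK : 0 < K)
    (A B u v w : Fin K → ℝ)
    (hA : ∀ k, 0 < A k) (hB : ∀ k, 0 ≤ B k) (hu : ∀ k, 0 ≤ u k)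
    (hv : ∀ k, 0 < v k) (hw : ∀ k, 0 < w k)
    (R a b Cbar : ℝ) (hR : 0 < R) (ha : 0 < a)
    (fstar : Fin K → ℝ)
    (hfeas : (∀ k, 0 < fstar k) ∧
      (∑ k, (u k + v k * fstar k + w k * fstar k ^ 2)) ≤ Cbar)
    (hmin : ∀ f : Fin K → ℝ, (∀ k, 0 < f k) →
      (∑ k, (u k + v k * f k + w k * f k ^ 2)) ≤ Cbar →
      a * R * (⨆ k, (A k / fstar k + B k)) + b ≤ a * R * (⨆ k, (A k / f k + B k)) + b)
    (Bstar : ℝ) (hBstar : Bstar = a * R * (⨆ k, (A k / fstar k + B k)) + b) :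
    (∀ k, R * B k < (Bstar - b) / a) ∧
    (∑ k, (u k + v k * (A k * R / ((Bstar - b) / a - R * B k))
      + w k * (A k * R / ((Bstar - b) / a - R * B k)) ^ 2)) = Cbar := by
  obtain ⟨hpos, hcost⟩ := hfeas
  haveI : Nonempty (Fin K) := ⟨⟨0, hK⟩⟩
  set φ : ℝ := ⨆ k, (A k / fstar k + B k) with hφ
  have hle : ∀ k, A k / fstar k + B k ≤ φ := fun k =>
    le_ciSup (f := fun k => A k / fstar k + B k) (Set.finite_range _).bddAbove k
  have hlt : ∀ k, B k < φ := fun k => by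
    have h1 := div_pos (hA k) (hpos k)
    have h2 := hle k
    linarith
  have hBa : (Bstar - b) / a = R * φ := by
    rw [hBstar]; field_simp; ring
  have hg : ∀ k, A k * R / ((Bstar - b) / a - R * B k) = A k / (φ - B k) := fun k => by
    have h1 : φ - B k ≠ 0 := (sub_pos.2 (hlt k)).ne'
    rw [hBa, ← mul_sub, mul_comm (A k) R, mul_div_mul_left _ _ hR.ne']
  refine ⟨fun k => by rw [hBa]; exact mul_lt_mul_of_pos_left (hlt k) hR, ?_⟩
  simp only [hg]
  have hgle : ∀ k, A k / (φ - B k) ≤ fstar k := fun k => by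
    rw [div_le_iff₀ (sub_pos.2 (hlt k))]
    have h1 : A k / fstar k ≤ φ - B k := by linarith [hle k]
    rw [div_le_iff₀ (hpos k)] at h1
    linarith
  have hub : ∑ k, (u k + v k * (A k / (φ - B k)) + w k * (A k / (φ - B k)) ^ 2) ≤ Cbar := by
    refine le_trans (Finset.sum_le_sum fun k _ => ?_) hcost
    have h0 : 0 ≤ A k / (φ - B k) := (div_pos (hA k) (sub_pos.2 (hlt k))).le
    have h1 := mul_le_mul_of_nonneg_left (hgle k) (hv k).le
    have h2 := mul_le_mul_of_nonneg_left (pow_le_pow_left₀ h0 (hgle k) 2) (hw k).le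
    linarith
  by_contra hne
  have hslt := lt_of_le_of_ne hub hne
  have hcont : ContinuousAt
      (fun t : ℝ => ∑ k, (u k + v k * (A k / (t - B k)) + w k * (A k / (t - B k)) ^ 2)) φ := by
    refine tendsto_finsetSum _ fun k _ => ?_
    have h1 : φ - B k ≠ 0 := (sub_pos.2 (hlt k)).ne'
    have hd : ContinuousAt (fun t : ℝ => A k / (t - B k)) φ :=
      continuousAt_const.div (continuousAt_id.sub continuousAt_const) h1
    exact (continuousAt_const.add (continuousAt_const.mul hd)).add
      (continuousAt_const.mul (hd.pow 2))
  have e1 := hcont.eventually (gt_mem_nhds hslt)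
  have e2 : ∀ᶠ t in nhds φ, ∀ k, B k < t :=
    Filter.eventually_all.2 fun k => lt_mem_nhds (hlt k)
  obtain ⟨t, ⟨ht1, ht2⟩, ht3⟩ :=
    (((e1.and e2).filter_mono nhdsWithin_le_nhds).and
      (self_mem_nhdsWithin : Set.Iio φ ∈ nhdsWithin φ (Set.Iio φ))).exists
  have hm := hmin (fun k => A k / (t - B k))
    (fun k => div_pos (hA k) (sub_pos.2 (ht2 k))) (le_of_lt ht1)
  have hs : (⨆ k, (A k / (A k / (t - B k)) + B k)) = t := by
    have : ∀ k, A k / (A k / (t - B k)) + B k = t := fun k => by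
      rw [div_div_cancel₀ (hA k).ne']; ring
    simp only [this, ciSup_const]
  rw [hs] at hm
  have h3 : t < φ := ht3
  have := mul_lt_mul_of_pos_left h3 (mul_pos ha hR)
  linarith
end
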